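/- arXiv:0911.1984 — 2 statements merged into one kernel-verified Lean document; each statement's English description precedes it below -/
import Mathlib

section
/- Let T be an ergodic measure-preserving transformation of a probability space (X, μ), and let h : X → ℝ be a measurable nonnegative function of the form h = f + g∘T − g, where f ∈ L¹ has ∫ f dμ = 0 and g is measurable and finite a.e. (not necessarily integrable). Then h = 0 μ-almost everywhere. -/
open MeasureTheory

open Filter in
/-- If a coboundary `g ∘ T - g` is bounded below by `-F` with `F` integrable, then the integral of
`g ∘ T - g + F ≥ 0` is at most that of `F`. No integrability of `g` is assumed. -/
theorem MeasureTheory.MeasurePreserving.lintegral_coboundary_add_le {X : Type*}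
    [MeasurableSpace X] {μ : Measure X} [IsFiniteMeasure μ] {T : X → X}
    (hT : MeasurePreserving T μ μ) {F g : X → ℝ} (hF : Integrable F μ) (hF₀ : 0 ≤ F)
    (hg : Measurable g) (hle : ∀ᵐ x ∂μ, g x ≤ g (T x) + F x) :
    ∫⁻ x, ENNReal.ofReal (g (T x) - g x + F x) ∂μ ≤ ENNReal.ofReal (∫ x, F x ∂μ) := by
  let c : ℕ → X → ℝ := fun n x ↦ max (-(n : ℝ)) (min (g x) n)
  have hc_meas (n : ℕ) : Measurable (c n) := measurable_const.max (hg.min measurable_const)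
  have hc_int (n : ℕ) : Integrable (c n) μ := by
    refine .of_bound (hc_meas n).aestronglyMeasurable (n : ℝ) (.of_forall fun x ↦ ?_)
    have hn : (0 : ℝ) ≤ n := n.cast_nonneg
    exact abs_le.2 ⟨le_max_left _ _, max_le (by linarith) (min_le_right _ _)⟩
  have hcT_int (n : ℕ) : Integrable (fun x ↦ c n (T x)) μ :=
    hT.integrable_comp_of_integrable (hc_int n)
  have hsub_int (n : ℕ) : Integrable (fun x ↦ c n (T x) - c n x) μ := (hcT_int n).sub (hc_int n)
  have hadd_int (n : ℕ) : Integrable (fun x ↦ c n (T x) - c n x + F x) μ := (hsub_int n).add hF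
  have hc_lim (x : X) : ∀ᶠ n in atTop, c n x = g x := by
    filter_upwards [eventually_ge_atTop ⌈|g x|⌉₊] with n hn
    have := abs_le.1 (Nat.ceil_le.1 hn)
    simp only [c]
    rw [min_eq_left this.2, max_eq_right this.1]
  have hlintegral (n : ℕ) :
      ∫⁻ x, ENNReal.ofReal (c n (T x) - c n x + F x) ∂μ = ENNReal.ofReal (∫ x, F x ∂μ) := by
    have hnonneg : 0 ≤ᵐ[μ] fun x ↦ c n (T x) - c n x + F x := by
      filter_upwards [hle] with x hx
      have := hF₀ x
      simp only [Pi.zero_apply, c] at this ⊢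
      grind
    rw [← ofReal_integral_eq_lintegral_ofReal (hadd_int n) hnonneg,
      integral_add (hsub_int n) hF, integral_sub (hcT_int n) (hc_int n)]
    have : ∫ x, c n (T x) ∂μ = ∫ x, c n x ∂μ := by
      conv_rhs => rw [← hT.map_eq]
      exact (integral_map hT.aemeasurable (hc_meas n).aestronglyMeasurable).symm
    rw [this, sub_self, zero_add]
  calc ∫⁻ x, ENNReal.ofReal (g (T x) - g x + F x) ∂μ
      = ∫⁻ x, liminf (fun n ↦ ENNReal.ofReal (c n (T x) - c n x + F x)) atTop ∂μ := by
        refine lintegral_congr fun x ↦ (Tendsto.liminf_eq ?_).symm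
        refine tendsto_const_nhds.congr' ?_
        filter_upwards [hc_lim x, hc_lim (T x)] with n h₁ h₂
        rw [h₁, h₂]
    _ ≤ liminf (fun n ↦ ∫⁻ x, ENNReal.ofReal (c n (T x) - c n x + F x) ∂μ) atTop :=
        lintegral_liminf_le' fun n ↦ (hadd_int n).aemeasurable.ennreal_ofReal
    _ = ENNReal.ofReal (∫ x, F x ∂μ) := by simp only [hlintegral, liminf_const]

theorem stmt_3 {X : Type*} [MeasurableSpace X] (μ : Measure X) [IsProbabilityMeasure μ]
    (T : X → X) (hT : Ergodic T μ) (f g h : X → ℝ)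
    (hf : Integrable f μ) (hmean : ∫ x, f x ∂μ = 0)
    (hg : Measurable g) (hmeas : Measurable h)
    (heq : ∀ᵐ x ∂μ, h x = f x + g (T x) - g x)
    (hnn : ∀ᵐ x ∂μ, 0 ≤ h x) :
    h =ᵐ[μ] 0 := by
  have hsub : Integrable (fun x ↦ |f x| - f x) μ := hf.abs.sub hf
  have hsub_nonneg (x : X) : 0 ≤ |f x| - f x := sub_nonneg.2 (le_abs_self _)
  have hsub_lintegral :
      ∫⁻ x, ENNReal.ofReal (|f x| - f x) ∂μ = ENNReal.ofReal (∫ x, |f x| ∂μ) := by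
    rw [← ofReal_integral_eq_lintegral_ofReal hsub (.of_forall hsub_nonneg),
      integral_sub hf.abs hf, hmean, sub_zero]
  have hle := hT.toMeasurePreserving.lintegral_coboundary_add_le hf.abs
    (fun x ↦ abs_nonneg (f x)) hg (by
      filter_upwards [heq, hnn] with x h₁ h₂
      linarith [le_abs_self (f x)])
  have hsplit : ∫⁻ x, ENNReal.ofReal (g (T x) - g x + |f x|) ∂μ
      = ∫⁻ x, ENNReal.ofReal (h x) ∂μ + ∫⁻ x, ENNReal.ofReal (|f x| - f x) ∂μ := by
    rw [← lintegral_add_left hmeas.ennreal_ofReal]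
    refine lintegral_congr_ae ?_
    filter_upwards [heq, hnn] with x h₁ h₂
    rw [← ENNReal.ofReal_add h₂ (hsub_nonneg x), h₁]
    congr 1
    ring
  rw [hsplit, hsub_lintegral] at hle
  have hzero : ∫⁻ x, ENNReal.ofReal (h x) ∂μ = 0 := by
    rw [← le_zero_iff, ← ENNReal.add_le_add_iff_right (ENNReal.ofReal_ne_top (r := ∫ x, |f x| ∂μ)),
      zero_add]
    exact hle
  filter_upwards [(lintegral_eq_zero_iff hmeas.ennreal_ofReal).1 hzero, hnn] with x h₁ h₂
  exact le_antisymm (ENNReal.ofReal_eq_zero.1 h₁) h₂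
end

section
/- (Siegel's formula in dimension 2) Let f ∈ L¹(ℝ²). Then the integral over the space X₁ = SL(2,ℤ)\SL(2,ℝ) of unimodular lattices, with respect to the Haar probability measure ν₁, of the sum of f over the nonzero points of the lattice ℤ²M equals the integral of f over ℝ²: ∫_{X₁} Σ_{k ∈ ℤ²∖{0}} f(kM) dν₁(M) = ∫_{ℝ²} f(x) dx. -/
open Matrix MeasureTheory

/-- The subgroup `SL(2,ℤ)` inside `SL(2,ℝ)`. -/
noncomputable def SL2Z : Subgroup (Matrix.SpecialLinearGroup (Fin 2) ℝ) :=
  (Matrix.SpecialLinearGroup.map (Int.castRingHom ℝ)).range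

noncomputable instance : MeasurableSpace (Matrix.SpecialLinearGroup (Fin 2) ℝ) :=
  MeasurableSpace.comap (fun M => (M : Matrix (Fin 2) (Fin 2) ℝ))
    (inferInstance : MeasurableSpace (Fin 2 → Fin 2 → ℝ))

/-- The space `X₁ = SL(2,ℤ)\SL(2,ℝ)` of right cosets (unimodular lattices). -/
def X1 : Type := Quotient (QuotientGroup.rightRel SL2Z)

noncomputable instance : MeasurableSpace X1 :=
  @Quotient.instMeasurableSpace _ (QuotientGroup.rightRel SL2Z) _

/-- Right translation by `g` on the space of right cosets. -/
noncomputable def rightTranslate (g : Matrix.SpecialLinearGroup (Fin 2) ℝ) :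
    X1 → X1 :=
  Quotient.map' (fun h => h * g) (by
    intro a b hab
    rw [QuotientGroup.rightRel_apply] at hab ⊢
    simpa [mul_assoc] using hab)

namespace SiegelFormula

open Filter Topology
open scoped ENNReal Pointwise

/-- The group of upper triangular matrices `!![exp u, v; 0, exp (-u)]`, with the opposite of matrix
multiplication, so that left translation by `p` is the action of the matrix `p` on row vectors. -/
structure Borel where
  /-- Logarithm of the upper left entry. -/
  log : ℝ
  /-- Upper right entry. -/
  off : ℝ

namespace Borel

noncomputable instance : Group Borel where
  mul p q := ⟨p.log + q.log, p.off * Real.exp q.log + q.off * Real.exp (-p.log)⟩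
  one := ⟨0, 0⟩
  inv p := ⟨-p.log, -p.off⟩
  mul_assoc p q r := by
    change Borel.mk (p.log + q.log + r.log) ((p.off * Real.exp q.log + q.off * Real.exp (-p.log)) *
      Real.exp r.log + r.off * Real.exp (-(p.log + q.log))) =
      Borel.mk (p.log + (q.log + r.log)) (p.off * Real.exp (q.log + r.log) +
        (q.off * Real.exp r.log + r.off * Real.exp (-q.log)) * Real.exp (-p.log))
    simp only [neg_add, Real.exp_add, mk.injEq]
    constructor <;> ring
  one_mul p := by
    change Borel.mk (0 + p.log) (0 * Real.exp p.log + p.off * Real.exp (-0)) = p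
    simp
  mul_one p := by
    change Borel.mk (p.log + 0) (p.off * Real.exp 0 + 0 * Real.exp (-p.log)) = p
    simp
  inv_mul_cancel p := by
    change Borel.mk (-p.log + p.log) (-p.off * Real.exp p.log + p.off * Real.exp (- -p.log)) =
      ⟨0, 0⟩
    simp

lemma log_mul (p q : Borel) : (p * q).log = p.log + q.log := rfl

lemma off_mul (p q : Borel) :
    (p * q).off = p.off * Real.exp q.log + q.off * Real.exp (-p.log) := rfl

/-- The first row of an upper triangular matrix. -/
noncomputable def row (p : Borel) : Fin 2 → ℝ := ![Real.exp p.log, p.off]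

instance : MeasurableSpace Borel := MeasurableSpace.comap (fun p => (p.log, p.off)) inferInstance

lemma measurable_log : Measurable log :=
  measurable_fst.comp (comap_measurable fun p : Borel => (p.log, p.off))

lemma measurable_off : Measurable off :=
  measurable_snd.comp (comap_measurable fun p : Borel => (p.log, p.off))

lemma measurable_of_coords {α : Type*} [MeasurableSpace α] {F : α → Borel}
    (h₁ : Measurable fun a => (F a).log) (h₂ : Measurable fun a => (F a).off) : Measurable F :=
  measurable_comap_iff.2 (h₁.prodMk h₂)

instance : MeasurableMul₂ Borel where
  measurable_mul := by
    have h₁ := measurable_log.comp (measurable_fst : Measurable (Prod.fst : Borel × Borel → Borel))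
    have h₂ := measurable_log.comp (measurable_snd : Measurable (Prod.snd : Borel × Borel → Borel))
    have h₃ := measurable_off.comp (measurable_fst : Measurable (Prod.fst : Borel × Borel → Borel))
    have h₄ := measurable_off.comp (measurable_snd : Measurable (Prod.snd : Borel × Borel → Borel))
    exact measurable_of_coords (h₁.add h₂) ((h₃.mul h₂.exp).add (h₄.mul h₁.neg.exp))

instance : MeasurableInv Borel where
  measurable_inv := measurable_of_coords measurable_log.neg measurable_off.neg

lemma measurable_row : Measurable row := by
  refine measurable_pi_lambda _ fun i => ?_
  fin_cases i
  · exact measurable_log.exp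
  · exact measurable_off

/-- The inverse of `row` on the right half-plane. -/
noncomputable def ofRow (x : Fin 2 → ℝ) : Borel := ⟨Real.log (x 0), x 1⟩

lemma measurable_ofRow : Measurable ofRow :=
  measurable_of_coords (measurable_pi_apply 0).log (measurable_pi_apply 1)

lemma ofRow_row (p : Borel) : ofRow (row p) = p := by simp [ofRow, row]

lemma row_ofRow {x : Fin 2 → ℝ} (hx : 0 < x 0) : row (ofRow x) = x := by
  ext i
  fin_cases i <;> simp [ofRow, row, Real.exp_log hx]

lemma row_zero_pos (p : Borel) : 0 < row p 0 := by simp [row, Real.exp_pos]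

lemma range_row : Set.range row = {x : Fin 2 → ℝ | 0 < x 0} := by
  ext x
  exact ⟨by rintro ⟨p, rfl⟩; exact row_zero_pos p, fun hx => ⟨_, row_ofRow hx⟩⟩

lemma measurableEmbedding_row : MeasurableEmbedding row :=
  MeasurableEmbedding.of_measurable_inverse measurable_row
    (by rw [range_row]; exact measurableSet_lt measurable_const (measurable_pi_apply 0))
    measurable_ofRow ofRow_row

/-- The element of `SL(2,ℝ)` corresponding to an element of the Borel subgroup. -/
noncomputable def toSL (p : Borel) : SpecialLinearGroup (Fin 2) ℝ :=
  ⟨!![Real.exp p.log, p.off; 0, Real.exp (-p.log)], by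
    simp [Matrix.det_fin_two, ← Real.exp_add]⟩

lemma vecMul_toSL (p : Borel) (x : Fin 2 → ℝ) :
    x ᵥ* (p.toSL : Matrix (Fin 2) (Fin 2) ℝ) =
      ![x 0 * Real.exp p.log, x 0 * p.off + x 1 * Real.exp (-p.log)] := by
  ext i
  fin_cases i <;> simp [toSL, Matrix.vecMul, dotProduct, Fin.sum_univ_two]

lemma row_mul (p q : Borel) :
    row (p * q) = row q ᵥ* (p.toSL : Matrix (Fin 2) (Fin 2) ℝ) := by
  rw [vecMul_toSL]
  ext i
  fin_cases i <;> simp [row, log_mul, off_mul, Real.exp_add] <;> ring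

end Borel

lemma vecMul_coe_mul {R : Type*} [CommRing R] (x : Fin 2 → R)
    (g h : SpecialLinearGroup (Fin 2) R) :
    x ᵥ* ((g * h : SpecialLinearGroup (Fin 2) R) : Matrix (Fin 2) (Fin 2) R) =
      (x ᵥ* (g : Matrix (Fin 2) (Fin 2) R)) ᵥ* (h : Matrix (Fin 2) (Fin 2) R) := by
  rw [Matrix.vecMul_vecMul]
  rfl

lemma vecMul_vecMul_cancel {R : Type*} [CommRing R] (x : Fin 2 → R)
    {g h : SpecialLinearGroup (Fin 2) R} (hgh : g * h = 1) :
    (x ᵥ* (g : Matrix (Fin 2) (Fin 2) R)) ᵥ* (h : Matrix (Fin 2) (Fin 2) R) = x := by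
  rw [← vecMul_coe_mul, hgh]
  exact Matrix.vecMul_one x

/-- Invariance of a measure on the plane under the right action of `SL(2,ℝ)` on row vectors. -/
def Invariant (μ : Measure (Fin 2 → ℝ)) : Prop :=
  ∀ g : SpecialLinearGroup (Fin 2) ℝ,
    μ.map (fun x => x ᵥ* (g : Matrix (Fin 2) (Fin 2) ℝ)) = μ

lemma continuous_vecMul_right (g : Matrix (Fin 2) (Fin 2) ℝ) :
    Continuous fun x : Fin 2 → ℝ => x ᵥ* g :=
  Continuous.matrix_vecMul continuous_id continuous_const

lemma Invariant.preimage {μ : Measure (Fin 2 → ℝ)} (h : Invariant μ)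
    (g : SpecialLinearGroup (Fin 2) ℝ) {A : Set (Fin 2 → ℝ)} (hA : MeasurableSet A) :
    μ ((fun x => x ᵥ* (g : Matrix (Fin 2) (Fin 2) ℝ)) ⁻¹' A) = μ A := by
  conv_rhs => rw [← h g]
  rw [Measure.map_apply (continuous_vecMul_right _).measurable hA]

lemma invariant_volume : Invariant (volume : Measure (Fin 2 → ℝ)) := by
  intro g
  have h : (fun x : Fin 2 → ℝ => x ᵥ* (g : Matrix (Fin 2) (Fin 2) ℝ)) =
      toLin' (g : Matrix (Fin 2) (Fin 2) ℝ)ᵀ := by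
    ext1 x
    rw [toLin'_apply, mulVec_transpose]
  rw [h, Real.map_matrix_volume_pi_eq_smul_volume_pi (by simp)]
  simp

/-- The open square with vertices `(±1/2, ±1/2)`. -/
def smallSquare : Set (Fin 2 → ℝ) := Metric.ball 0 (1 / 2)

lemma measurableSet_smallSquare : MeasurableSet smallSquare := measurableSet_ball

lemma mem_smallSquare {x : Fin 2 → ℝ} : x ∈ smallSquare ↔ |x 0| < 1 / 2 ∧ |x 1| < 1 / 2 := by
  rw [smallSquare, mem_ball_zero_iff, pi_norm_lt_iff (by norm_num)]
  simp [Fin.forall_fin_two]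

lemma Invariant.isMulLeftInvariant_comap {μ : Measure (Fin 2 → ℝ)} (h : Invariant μ) :
    (μ.comap Borel.row).IsMulLeftInvariant := by
  refine ⟨fun p => ?_⟩
  ext A hA
  have hrow := Borel.measurableEmbedding_row
  rw [Measure.map_apply (measurable_const_mul p) hA, hrow.comap_apply, hrow.comap_apply,
    ← h.preimage p.toSL (hrow.measurableSet_image.2 hA)]
  congr 1
  ext x
  constructor
  · rintro ⟨q, hq, rfl⟩
    exact ⟨p * q, hq, Borel.row_mul p q⟩
  · rintro ⟨a, ha, hax⟩
    have hx : 0 < x 0 := by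
      have h₀ := Borel.row_zero_pos a
      rw [hax] at h₀
      simp only [Borel.vecMul_toSL, cons_val_zero] at h₀
      exact pos_of_mul_pos_left h₀ (Real.exp_pos _).le
    refine ⟨Borel.ofRow x, ?_, Borel.row_ofRow hx⟩
    have : p * Borel.ofRow x = a := by
      apply hrow.injective
      rw [Borel.row_mul, Borel.row_ofRow hx, hax]
    simpa [this] using ha

/-- Every point of the right half-plane is carried into the small square by one of countably many
upper triangular matrices. -/
lemma exists_vecMul_mem_smallSquare {x : Fin 2 → ℝ} (hx : 0 < x 0) :
    ∃ nt : ℕ × ℤ, x ᵥ* ((Borel.mk (-nt.1) (nt.2 * Real.exp (-nt.1))).toSL :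
      Matrix (Fin 2) (Fin 2) ℝ) ∈ smallSquare := by
  have hlim : Tendsto (fun n : ℕ => x 0 * Real.exp (-(n : ℝ))) atTop (𝓝 (x 0 * 0)) :=
    (Real.tendsto_exp_neg_atTop_nhds_zero.comp tendsto_natCast_atTop_atTop).const_mul _
  rw [mul_zero] at hlim
  obtain ⟨n, hn⟩ := (hlim.eventually (gt_mem_nhds (show (0 : ℝ) < 1 / 2 by norm_num))).exists
  set d := x 0 * Real.exp (-(n : ℝ)) with hd
  have hdpos : 0 < d := mul_pos hx (Real.exp_pos _)
  set y := x 1 * Real.exp (n : ℝ) with hy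
  refine ⟨(n, -⌊y / d⌋), ?_⟩
  rw [mem_smallSquare, Borel.vecMul_toSL]
  have h₁ := Int.floor_le (y / d)
  have h₂ := Int.lt_floor_add_one (y / d)
  rw [le_div_iff₀ hdpos] at h₁
  rw [div_lt_iff₀ hdpos] at h₂
  simp only [cons_val_zero, cons_val_one, neg_neg, Int.cast_neg]
  rw [show x 0 * (-(⌊y / d⌋ : ℝ) * Real.exp (-(n : ℝ))) = -(⌊y / d⌋ * d) by rw [hd]; ring, ← hd,
    ← hy]
  refine ⟨by rw [abs_of_pos hdpos]; exact hn, ?_⟩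
  rw [abs_lt]
  constructor <;> nlinarith

lemma Invariant.sigmaFinite_comap {μ : Measure (Fin 2 → ℝ)} (h : Invariant μ)
    (hfin : μ smallSquare ≠ ∞) : SigmaFinite (μ.comap Borel.row) := by
  have hrow := Borel.measurableEmbedding_row
  let g : ℕ × ℤ → SpecialLinearGroup (Fin 2) ℝ := fun nt =>
    (Borel.mk (-nt.1) (nt.2 * Real.exp (-nt.1))).toSL
  let S : ℕ × ℤ → Set Borel := fun nt =>
    Borel.row ⁻¹' ((fun x => x ᵥ* (g nt : Matrix (Fin 2) (Fin 2) ℝ)) ⁻¹' smallSquare)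
  have hS : ∀ nt, (μ.comap Borel.row) (S nt) < ∞ := fun nt => by
    rw [hrow.comap_apply]
    refine (measure_mono (Set.image_preimage_subset _ _)).trans_lt ?_
    rw [h.preimage _ measurableSet_smallSquare]
    exact hfin.lt_top
  refine ⟨⟨{
    set := fun n => ((Encodable.decode (α := ℕ × ℤ) n).elim ∅ S)
    set_mem := fun _ => trivial
    finite := fun n => ?_
    spanning := ?_ }⟩⟩
  · cases Encodable.decode (α := ℕ × ℤ) n with
    | none => simp
    | some a => exact hS a
  · rw [Set.eq_univ_iff_forall]
    intro p
    obtain ⟨nt, hnt⟩ := exists_vecMul_mem_smallSquare (Borel.row_zero_pos p)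
    exact Set.mem_iUnion.2 ⟨Encodable.encode nt, by
      rw [Encodable.encodek]; exact hnt⟩

/-- On the right half-plane, an `SL(2,ℝ)`-invariant measure that is finite near the origin is a
finite multiple of Lebesgue measure. -/
lemma Invariant.exists_eq_mul_volume_of_pos {μ : Measure (Fin 2 → ℝ)} (h : Invariant μ)
    (hfin : μ smallSquare ≠ ∞) : ∃ c : ℝ≥0∞, c ≠ ∞ ∧
      ∀ A ⊆ {x : Fin 2 → ℝ | 0 < x 0}, μ A = c * volume A := by
  have hrow := Borel.measurableEmbedding_row
  have hsqv : volume smallSquare ≠ ∞ := measure_ball_lt_top.ne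
  have := h.isMulLeftInvariant_comap
  have := invariant_volume.isMulLeftInvariant_comap
  have := h.sigmaFinite_comap hfin
  have := invariant_volume.sigmaFinite_comap hsqv
  let s : Set Borel := Borel.row ⁻¹' smallSquare
  have hs_open : IsOpen (smallSquare ∩ {x : Fin 2 → ℝ | 0 < x 0}) :=
    Metric.isOpen_ball.inter (isOpen_lt continuous_const (continuous_apply 0))
  have himg : Borel.row '' s = smallSquare ∩ {x : Fin 2 → ℝ | 0 < x 0} := by
    rw [Set.image_preimage_eq_inter_range, Borel.range_row]
  have h₀ : (volume.comap Borel.row) s ≠ 0 := by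
    rw [hrow.comap_apply, himg]
    refine (hs_open.measure_pos _ ⟨![1 / 4, 0], ?_⟩).ne'
    rw [Set.mem_inter_iff, mem_smallSquare]
    norm_num [abs_of_pos]
  have h₁ : (volume.comap Borel.row) s ≠ ∞ := by
    rw [hrow.comap_apply, himg]
    exact measure_ne_top_of_subset Set.inter_subset_left hsqv
  have h₂ : (μ.comap Borel.row) s ≠ ∞ := by
    rw [hrow.comap_apply, himg]
    exact measure_ne_top_of_subset Set.inter_subset_left hfin
  refine ⟨_, ENNReal.div_ne_top h₂ h₀, fun A hA => ?_⟩
  have key := congrArg (fun m => m (Borel.row ⁻¹' A))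
    (measure_eq_div_smul (μ.comap Borel.row) (volume.comap Borel.row) h₀ h₁)
  simp only [Measure.smul_apply, smul_eq_mul] at key
  rwa [hrow.comap_apply (μ := μ), hrow.comap_apply (μ := volume) (s := Borel.row ⁻¹' A),
    Set.image_preimage_eq_of_subset (by rwa [Borel.range_row])] at key

/-- An `SL(2,ℝ)`-invariant measure on the plane that is finite near the origin and has no atom
there is a finite multiple of Lebesgue measure. -/
theorem Invariant.exists_eq_smul_volume {μ : Measure (Fin 2 → ℝ)} (h : Invariant μ)
    (hfin : μ smallSquare ≠ ∞) (hzero : μ {0} = 0) : ∃ c : ℝ≥0∞, c ≠ ∞ ∧ μ = c • volume := by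
  obtain ⟨c, hc, hpos⟩ := h.exists_eq_mul_volume_of_pos hfin
  refine ⟨c, hc, ?_⟩
  let r : SpecialLinearGroup (Fin 2) ℝ := ⟨!![0, 1; -1, 0], by simp [Matrix.det_fin_two]⟩
  have hr : ∀ x : Fin 2 → ℝ, x ᵥ* (r : Matrix (Fin 2) (Fin 2) ℝ) = ![-x 1, x 0] := fun x => by
    ext i
    fin_cases i <;> simp [r, Matrix.vecMul, dotProduct, Fin.sum_univ_two]
  let P : Set (Fin 2 → ℝ) := {x | 0 < x 0}
  have hP : MeasurableSet P := measurableSet_lt measurable_const (measurable_pi_apply 0)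
  let N : Set (Fin 2 → ℝ) := {x | x 0 < 0}
  have hN : MeasurableSet N := measurableSet_lt (measurable_pi_apply 0) measurable_const
  have hvol_line : volume {x : Fin 2 → ℝ | x 0 = 0} = 0 :=
    Measure.pi_hyperplane (fun _ => volume) 0 0
  have hvol_line' : volume {x : Fin 2 → ℝ | x 1 = 0} = 0 :=
    Measure.pi_hyperplane (fun _ => volume) 1 0
  have hneg : ∀ A ⊆ N, MeasurableSet A → μ A = c * volume A := by
    intro A hA hAm
    rw [← h.preimage (r * r) hAm, ← invariant_volume.preimage (r * r) hAm]
    refine hpos _ fun x hx => ?_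
    have : (x ᵥ* ((r * r : SpecialLinearGroup (Fin 2) ℝ) : Matrix (Fin 2) (Fin 2) ℝ)) 0 < 0 :=
      hA hx
    rw [vecMul_coe_mul, hr, hr] at this
    simpa using this
  have hray : μ {x | 0 < x 0 ∧ x 1 = 0} = 0 := by
    rw [hpos _ (fun x hx => hx.1), measure_mono_null (fun x hx => hx.2) hvol_line', mul_zero]
  have hraym : MeasurableSet {x : Fin 2 → ℝ | 0 < x 0 ∧ x 1 = 0} :=
    hP.inter (measurableSet_eq_fun (measurable_pi_apply 1) measurable_const)
  have hline : μ {x | x 0 = 0} = 0 := by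
    refine measure_mono_null (t := {0} ∪ (((fun x => x ᵥ* (r : Matrix (Fin 2) (Fin 2) ℝ)) ⁻¹'
      {x | 0 < x 0 ∧ x 1 = 0}) ∪ ((fun x => x ᵥ* ((r * r * r : SpecialLinearGroup (Fin 2) ℝ) :
        Matrix (Fin 2) (Fin 2) ℝ)) ⁻¹' {x | 0 < x 0 ∧ x 1 = 0}))) ?_ ?_
    · intro x hx
      simp only [Set.mem_ofPred_eq] at hx
      simp only [Set.mem_union, Set.mem_singleton_iff, Set.mem_preimage, Set.mem_ofPred_eq,
        vecMul_coe_mul, hr]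
      rcases lt_trichotomy (x 1) 0 with h1 | h1 | h1
      · right; left; simpa [hx] using h1
      · left; ext i; fin_cases i <;> simp [hx, h1]
      · right; right; simpa [hx] using h1
    · simp only [measure_union_null_iff]
      exact ⟨hzero, by rw [h.preimage _ hraym, hray], by rw [h.preimage _ hraym, hray]⟩
  ext A hA
  have split : ∀ m : Measure (Fin 2 → ℝ), m {x | x 0 = 0} = 0 →
      m A = m (A ∩ P) + m (A ∩ N) := by
    intro m hm
    rw [← measure_inter_add_sdiff A hP]
    congr 1
    refine le_antisymm ?_ (measure_mono fun x hx => ⟨hx.1, fun hx' : 0 < x 0 =>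
      lt_asymm (show x 0 < 0 from hx.2) hx'⟩)
    calc m (A \ P) ≤ m (A ∩ N ∪ {x | x 0 = 0}) := measure_mono fun x hx => by
          rcases lt_trichotomy (x 0) 0 with h1 | h1 | h1
          · exact Or.inl ⟨hx.1, h1⟩
          · exact Or.inr h1
          · exact absurd h1 hx.2
      _ ≤ _ := (measure_union_le _ _).trans (by rw [hm, add_zero])
  rw [Measure.smul_apply, smul_eq_mul, split μ hline, split volume hvol_line, mul_add,
    hpos _ Set.inter_subset_right, hneg _ Set.inter_subset_right (hA.inter hN)]

/-- The point `kM` of the lattice `ℤ²M`. -/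
def latticePoint (k : Fin 2 → ℤ) (M : SpecialLinearGroup (Fin 2) ℝ) : Fin 2 → ℝ :=
  (fun i => (k i : ℝ)) ᵥ* (M : Matrix (Fin 2) (Fin 2) ℝ)

lemma latticePoint_apply (k : Fin 2 → ℤ) (M : SpecialLinearGroup (Fin 2) ℝ) (j : Fin 2) :
    latticePoint k M j = k 0 * M.1 0 j + k 1 * M.1 1 j := by
  simp [latticePoint, Matrix.vecMul, dotProduct, Fin.sum_univ_two]

lemma latticePoint_mul (k : Fin 2 → ℤ) (M g : SpecialLinearGroup (Fin 2) ℝ) :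
    latticePoint k (M * g) = latticePoint k M ᵥ* (g : Matrix (Fin 2) (Fin 2) ℝ) :=
  vecMul_coe_mul _ M g

lemma latticePoint_map_mul (k : Fin 2 → ℤ) (γ : SpecialLinearGroup (Fin 2) ℤ)
    (M : SpecialLinearGroup (Fin 2) ℝ) :
    latticePoint k (SpecialLinearGroup.map (Int.castRingHom ℝ) γ * M) =
      latticePoint (k ᵥ* (γ : Matrix (Fin 2) (Fin 2) ℤ)) M := by
  rw [latticePoint_mul]
  unfold latticePoint
  congr 1
  ext i
  simp [Matrix.vecMul, dotProduct]

lemma latticePoint_sub (k l : Fin 2 → ℤ) (M : SpecialLinearGroup (Fin 2) ℝ) :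
    latticePoint (k - l) M = latticePoint k M - latticePoint l M := by
  rw [latticePoint, latticePoint, latticePoint, ← Matrix.sub_vecMul]
  congr 1
  ext i
  simp

lemma latticePoint_smul (n : ℕ) (k : Fin 2 → ℤ) (M : SpecialLinearGroup (Fin 2) ℝ) :
    latticePoint (n • k) M = (n : ℝ) • latticePoint k M := by
  rw [latticePoint, latticePoint, ← Matrix.smul_vecMul]
  congr 1
  ext i
  simp

lemma det_latticePoint (k l : Fin 2 → ℤ) (M : SpecialLinearGroup (Fin 2) ℝ) :
    latticePoint k M 0 * latticePoint l M 1 - latticePoint k M 1 * latticePoint l M 0 =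
      ((k 0 * l 1 - k 1 * l 0 : ℤ) : ℝ) := by
  have h : M.1 0 0 * M.1 1 1 - M.1 0 1 * M.1 1 0 = 1 := by
    rw [← Matrix.det_fin_two]; exact M.2
  simp only [latticePoint_apply]
  push_cast
  linear_combination (k 0 * l 1 - k 1 * l 0 : ℝ) * h

lemma latticePoint_ne_zero {k : Fin 2 → ℤ} (hk : k ≠ 0) (M : SpecialLinearGroup (Fin 2) ℝ) :
    latticePoint k M ≠ 0 := by
  intro h
  apply hk
  have h' := vecMul_vecMul_cancel (fun i => (k i : ℝ)) (mul_inv_cancel M)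
  rw [show (fun i => (k i : ℝ)) ᵥ* (M : Matrix (Fin 2) (Fin 2) ℝ) = 0 from h,
    Matrix.zero_vecMul] at h'
  ext i
  exact Int.cast_eq_zero.1 (congrFun h' i).symm

lemma measurable_entry (i j : Fin 2) :
    Measurable fun M : SpecialLinearGroup (Fin 2) ℝ => M.1 i j :=
  (measurable_pi_apply j).comp ((measurable_pi_apply i).comp
    (comap_measurable fun M : SpecialLinearGroup (Fin 2) ℝ => (M : Matrix (Fin 2) (Fin 2) ℝ)))

lemma measurable_latticePoint (k : Fin 2 → ℤ) : Measurable (latticePoint k) := by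
  refine measurable_pi_lambda _ fun j => ?_
  simp only [latticePoint_apply]
  exact ((measurable_entry 0 j).const_mul _).add ((measurable_entry 1 j).const_mul _)

/-- The counting measure on the points `kM` with `k` satisfying `p`. -/
noncomputable def pointMeasure (p : (Fin 2 → ℤ) → Prop) (M : SpecialLinearGroup (Fin 2) ℝ) :
    Measure (Fin 2 → ℝ) :=
  Measure.sum fun k : {v // p v} => Measure.dirac (latticePoint k M)

lemma pointMeasure_apply_tsum (p : (Fin 2 → ℤ) → Prop) (M : SpecialLinearGroup (Fin 2) ℝ)
    {A : Set (Fin 2 → ℝ)} (hA : MeasurableSet A) :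
    pointMeasure p M A = ∑' k : {v // p v}, A.indicator 1 (latticePoint k M) := by
  simp [pointMeasure, Measure.sum_apply _ hA, Measure.dirac_apply' _ hA]

lemma pointMeasure_apply (p : (Fin 2 → ℤ) → Prop) (M : SpecialLinearGroup (Fin 2) ℝ)
    {A : Set (Fin 2 → ℝ)} (hA : MeasurableSet A) :
    pointMeasure p M A = ({k | p k ∧ latticePoint k M ∈ A} : Set (Fin 2 → ℤ)).encard := by
  rw [pointMeasure_apply_tsum p M hA, ← ENNReal.tsum_set_one, tsum_subtype _ (fun _ => (1 : ℝ≥0∞))]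
  have : ∀ k : {v // p v}, A.indicator (1 : (Fin 2 → ℝ) → ℝ≥0∞) (latticePoint k M) =
      ({k | p k ∧ latticePoint k M ∈ A} : Set (Fin 2 → ℤ)).indicator (fun _ => 1) (k : Fin 2 → ℤ) :=
    fun k => by
      by_cases h : latticePoint k M ∈ A
      · rw [Set.indicator_of_mem h, Set.indicator_of_mem (Set.mem_ofPred_eq ▸ ⟨k.2, h⟩)]; rfl
      · rw [Set.indicator_of_notMem h, Set.indicator_of_notMem fun h' => h h'.2]
  simp_rw [this]
  refine tsum_subtype_eq_of_support_subset (s := {v | p v}) (f := Set.indicator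
    ({k | p k ∧ latticePoint k M ∈ A} : Set (Fin 2 → ℤ)) fun _ => (1 : ℝ≥0∞)) fun k hk => ?_
  exact (Set.mem_of_indicator_ne_zero hk).1

lemma measurable_pointMeasure (p : (Fin 2 → ℤ) → Prop) : Measurable (pointMeasure p) := by
  refine Measure.measurable_of_measurable_coe _ fun A hA => ?_
  simp only [pointMeasure_apply_tsum p _ hA]
  exact Measurable.tsum fun k =>
    (measurable_one.indicator hA).comp (measurable_latticePoint k)

lemma pointMeasure_mul (p : (Fin 2 → ℤ) → Prop) (M g : SpecialLinearGroup (Fin 2) ℝ) :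
    pointMeasure p (M * g) =
      (pointMeasure p M).map fun x => x ᵥ* (g : Matrix (Fin 2) (Fin 2) ℝ) := by
  have hg := (continuous_vecMul_right (g : Matrix (Fin 2) (Fin 2) ℝ)).measurable
  rw [pointMeasure, pointMeasure, Measure.map_sum hg.aemeasurable]
  congr 1
  ext1 k
  rw [Measure.map_dirac' hg, latticePoint_mul]

/-- A condition on integer vectors that is preserved by `SL(2,ℤ)`. -/
def Stable (p : (Fin 2 → ℤ) → Prop) : Prop :=
  ∀ (γ : SpecialLinearGroup (Fin 2) ℤ) (v : Fin 2 → ℤ),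
    p v → p (v ᵥ* (γ : Matrix (Fin 2) (Fin 2) ℤ))

lemma Stable.pointMeasure_map_mul {p : (Fin 2 → ℤ) → Prop} (hp : Stable p)
    (γ : SpecialLinearGroup (Fin 2) ℤ) (M : SpecialLinearGroup (Fin 2) ℝ) :
    pointMeasure p (SpecialLinearGroup.map (Int.castRingHom ℝ) γ * M) = pointMeasure p M := by
  let e : {v // p v} ≃ {v // p v} :=
    { toFun := fun v => ⟨v.1 ᵥ* (γ : Matrix (Fin 2) (Fin 2) ℤ), hp γ v.1 v.2⟩
      invFun := fun v => ⟨v.1 ᵥ* ((γ⁻¹ : SpecialLinearGroup (Fin 2) ℤ) :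
        Matrix (Fin 2) (Fin 2) ℤ), hp γ⁻¹ v.1 v.2⟩
      left_inv := fun v => Subtype.ext (vecMul_vecMul_cancel _ (mul_inv_cancel γ))
      right_inv := fun v => Subtype.ext (vecMul_vecMul_cancel _ (inv_mul_cancel γ)) }
  ext A hA
  rw [pointMeasure_apply_tsum p _ hA, pointMeasure_apply_tsum p _ hA,
    ← e.tsum_eq fun k : {v // p v} => A.indicator 1 (latticePoint k M)]
  simp only [latticePoint_map_mul]
  rfl

/-- The counting measure on the vectors of a unimodular lattice satisfying a stable condition. -/
noncomputable def latticeMeasure {p : (Fin 2 → ℤ) → Prop} (hp : Stable p) :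
    X1 → Measure (Fin 2 → ℝ) :=
  Quotient.lift (s := QuotientGroup.rightRel SL2Z) (pointMeasure p) fun a b hab => by
    have hab' : QuotientGroup.rightRel SL2Z a b := hab
    rw [QuotientGroup.rightRel_apply] at hab'
    obtain ⟨γ, hγ⟩ := hab'
    rw [← hp.pointMeasure_map_mul γ a, hγ, inv_mul_cancel_right]

lemma latticeMeasure_mk {p : (Fin 2 → ℤ) → Prop} (hp : Stable p)
    (M : SpecialLinearGroup (Fin 2) ℝ) :
    latticeMeasure hp (Quotient.mk'' M) = pointMeasure p M := rfl

lemma measurable_latticeMeasure {p : (Fin 2 → ℤ) → Prop} (hp : Stable p) :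
    Measurable (latticeMeasure hp) :=
  fun _ ht => measurable_pointMeasure p ht

lemma measurable_rightTranslate (g : SpecialLinearGroup (Fin 2) ℝ) :
    Measurable (rightTranslate g) := by
  have hmk : Measurable fun M : SpecialLinearGroup (Fin 2) ℝ => (Quotient.mk'' M : X1) :=
    fun _ ht => ht
  have hmul : Measurable fun M : SpecialLinearGroup (Fin 2) ℝ => M * g := by
    refine measurable_comap_iff.2 ?_
    refine measurable_pi_lambda _ fun i => measurable_pi_lambda _ fun j => ?_
    have hentry : ∀ M : SpecialLinearGroup (Fin 2) ℝ,
        (M * g).1 i j = M.1 i 0 * g.1 0 j + M.1 i 1 * g.1 1 j := fun M => by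
      rw [← Fin.sum_univ_two fun l => M.1 i l * g.1 l j]
      rfl
    change Measurable fun M : SpecialLinearGroup (Fin 2) ℝ => (M * g).1 i j
    simp only [hentry]
    exact ((measurable_entry i 0).mul_const _).add ((measurable_entry i 1).mul_const _)
  exact fun _ ht => hmk.comp hmul ht

lemma latticeMeasure_rightTranslate {p : (Fin 2 → ℤ) → Prop} (hp : Stable p)
    (g : SpecialLinearGroup (Fin 2) ℝ) (q : X1) :
    latticeMeasure hp (rightTranslate g q) =
      (latticeMeasure hp q).map fun x => x ᵥ* (g : Matrix (Fin 2) (Fin 2) ℝ) := by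
  induction q using Quotient.inductionOn' with
  | h M => exact pointMeasure_mul p M g

section Average

variable {ν : Measure X1}

lemma invariant_bind {p : (Fin 2 → ℤ) → Prop} (hp : Stable p)
    (hinv : ∀ g, ν.map (rightTranslate g) = ν) : Invariant (ν.bind (latticeMeasure hp)) := by
  intro g
  have hg := (continuous_vecMul_right (g : Matrix (Fin 2) (Fin 2) ℝ)).measurable
  have hm := measurable_latticeMeasure hp
  ext A hA
  rw [Measure.map_apply hg hA, Measure.bind_apply (hg hA) hm.aemeasurable,
    Measure.bind_apply hA hm.aemeasurable]
  conv_rhs => rw [← hinv g]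
  rw [lintegral_map (f := fun q => latticeMeasure hp q A)
    ((Measure.measurable_coe hA).comp hm) (measurable_rightTranslate g)]
  refine lintegral_congr fun q => ?_
  rw [latticeMeasure_rightTranslate, Measure.map_apply hg hA]

lemma bind_singleton_zero {p : (Fin 2 → ℤ) → Prop} (hp : Stable p) (hp₀ : ∀ v, p v → v ≠ 0) :
    ν.bind (latticeMeasure hp) {0} = 0 := by
  have hz : MeasurableSet ({0} : Set (Fin 2 → ℝ)) := measurableSet_singleton 0
  rw [Measure.bind_apply hz (measurable_latticeMeasure hp).aemeasurable]
  convert lintegral_zero with q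
  induction q using Quotient.inductionOn' with
  | h M =>
    rw [latticeMeasure_mk, pointMeasure_apply_tsum p _ hz]
    simp only [ENNReal.tsum_eq_zero]
    exact fun k => Set.indicator_of_notMem
      (fun hk => latticePoint_ne_zero (hp₀ _ k.2) M (Set.mem_singleton_iff.1 hk)) _

lemma stable_ne_zero : Stable fun v => v ≠ 0 := by
  intro γ v hv h
  apply hv
  rw [← vecMul_vecMul_cancel v (mul_inv_cancel γ), h, Matrix.zero_vecMul]

lemma stable_isCoprime : Stable fun v => IsCoprime (v 0) (v 1) :=
  fun γ _ hv => hv.vecMulSL γ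

lemma eq_or_eq_neg_of_isCoprime {k l : Fin 2 → ℤ} (hk : IsCoprime (k 0) (k 1))
    (hl : IsCoprime (l 0) (l 1)) (h : k 0 * l 1 - k 1 * l 0 = 0) : l = k ∨ l = -k := by
  obtain ⟨a, b, hab⟩ := hk
  set t := a * l 0 + b * l 1 with ht
  have h₀ : l 0 = t * k 0 := by linear_combination (-l 0) * hab - b * h
  have h₁ : l 1 = t * k 1 := by linear_combination (-l 1) * hab + a * h
  have hu : IsUnit t := hl.isUnit_of_dvd' ⟨_, h₀⟩ ⟨_, h₁⟩
  rcases Int.isUnit_iff.1 hu with h1 | h1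
  · left; ext i; fin_cases i <;> simp [h₀, h₁, h1]
  · right; ext i; fin_cases i <;> simp [h₀, h₁, h1]

/-- A unimodular lattice has at most one pair of primitive vectors in the small square. -/
lemma pointMeasure_isCoprime_smallSquare_le (M : SpecialLinearGroup (Fin 2) ℝ) :
    pointMeasure (fun v => IsCoprime (v 0) (v 1)) M smallSquare ≤ 2 := by
  rw [pointMeasure_apply _ _ measurableSet_smallSquare]
  suffices h : ({k | IsCoprime (k 0) (k 1) ∧ latticePoint k M ∈ smallSquare} :
      Set (Fin 2 → ℤ)).encard ≤ 2 by exact_mod_cast h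
  rcases Set.eq_empty_or_nonempty
    {k : Fin 2 → ℤ | IsCoprime (k 0) (k 1) ∧ latticePoint k M ∈ smallSquare} with h | ⟨k, hk⟩
  · rw [h]; simp
  · refine (Set.encard_le_encard (t := {k, -k}) fun l hl => ?_).trans
      ((Set.encard_insert_le _ _).trans (by rw [Set.encard_singleton, one_add_one_eq_two]))
    have hk' := mem_smallSquare.1 hk.2
    have hl' := mem_smallSquare.1 hl.2
    refine eq_or_eq_neg_of_isCoprime hk.1 hl.1 (Int.abs_lt_one_iff.1 ?_)
    have hdet := det_latticePoint k l M
    have hlt : |((k 0 * l 1 - k 1 * l 0 : ℤ) : ℝ)| < 1 := by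
      rw [← hdet]
      have h₁ := mul_lt_mul'' hk'.1 hl'.2 (abs_nonneg _) (abs_nonneg _)
      have h₂ := mul_lt_mul'' hk'.2 hl'.1 (abs_nonneg _) (abs_nonneg _)
      rw [← abs_mul] at h₁ h₂
      refine (abs_sub _ _).trans_lt ?_
      linarith
    exact_mod_cast hlt

lemma bind_isCoprime_smallSquare_ne_top [IsProbabilityMeasure ν] :
    ν.bind (latticeMeasure stable_isCoprime) smallSquare ≠ ∞ := by
  rw [Measure.bind_apply measurableSet_smallSquare (measurable_latticeMeasure _).aemeasurable]
  have h : ∫⁻ q, latticeMeasure stable_isCoprime q smallSquare ∂ν ≤ ∫⁻ _, 2 ∂ν := by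
    refine lintegral_mono fun q => ?_
    induction q using Quotient.inductionOn' with
    | h M => exact pointMeasure_isCoprime_smallSquare_le M
  refine (h.trans_lt ?_).ne
  simp

lemma exists_eq_smul_isCoprime {v : Fin 2 → ℤ} (hv : v ≠ 0) :
    ∃ (n : ℕ) (w : Fin 2 → ℤ), IsCoprime (w 0) (w 1) ∧ v = (n + 1) • w := by
  have hpos : 0 < Int.gcd (v 0) (v 1) := by
    refine Nat.pos_of_ne_zero fun h => hv ?_
    rw [Int.gcd_eq_zero_iff] at h
    ext i
    fin_cases i
    · exact h.1
    · exact h.2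
  obtain ⟨a, b, hab, ha, hb⟩ := Int.exists_gcd_one hpos
  refine ⟨Int.gcd (v 0) (v 1) - 1, ![a, b], Int.isCoprime_iff_gcd_eq_one.2 hab, ?_⟩
  rw [Nat.sub_add_cancel hpos]
  ext i
  fin_cases i
  · simpa [mul_comm] using ha
  · simpa [mul_comm] using hb

lemma pointMeasure_ne_zero_le_tsum (M : SpecialLinearGroup (Fin 2) ℝ) {A : Set (Fin 2 → ℝ)}
    (hA : MeasurableSet A) :
    pointMeasure (fun v => v ≠ 0) M A ≤ ∑' n : ℕ, pointMeasure (fun v => IsCoprime (v 0) (v 1)) M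
      ((fun x => ((n + 1 : ℕ) : ℝ) • x) ⁻¹' A) := by
  choose n w hw hv using fun v : {v : Fin 2 → ℤ // v ≠ 0} => exists_eq_smul_isCoprime v.2
  let φ : {v : Fin 2 → ℤ // v ≠ 0} → ℕ × {v : Fin 2 → ℤ // IsCoprime (v 0) (v 1)} :=
    fun v => (n v, ⟨w v, hw v⟩)
  have hφ : Function.Injective φ := fun v v' h => by
    simp only [φ, Prod.mk.injEq, Subtype.mk.injEq] at h
    exact Subtype.ext (by rw [hv v, hv v', h.1, h.2])
  let F : ℕ × {v : Fin 2 → ℤ // IsCoprime (v 0) (v 1)} → ℝ≥0∞ := fun a =>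
    A.indicator 1 (((a.1 + 1 : ℕ) : ℝ) • latticePoint a.2 M)
  calc pointMeasure (fun v => v ≠ 0) M A = ∑' v, F (φ v) := by
        rw [pointMeasure_apply_tsum _ _ hA]
        refine tsum_congr fun v => ?_
        simp only [F, φ]
        rw [← latticePoint_smul, ← hv v]
    _ ≤ ∑' a, F a := ENNReal.tsum_comp_le_tsum_of_injective hφ F
    _ = _ := by
        rw [ENNReal.tsum_prod']
        refine tsum_congr fun m => ?_
        rw [pointMeasure_apply_tsum _ _ (measurable_const_smul (_ : ℝ) hA)]
        rfl

lemma bind_ne_zero_smallSquare_ne_top [IsProbabilityMeasure ν]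
    (hinv : ∀ g, ν.map (rightTranslate g) = ν) :
    ν.bind (latticeMeasure stable_ne_zero) smallSquare ≠ ∞ := by
  obtain ⟨c, hc, hμ⟩ := (invariant_bind stable_isCoprime hinv).exists_eq_smul_volume
    bind_isCoprime_smallSquare_ne_top (bind_singleton_zero stable_isCoprime fun v hv h => by
      simp [h, isCoprime_zero_left] at hv)
  have hpre : ∀ n : ℕ, MeasurableSet ((fun x : Fin 2 → ℝ => ((n + 1 : ℕ) : ℝ) • x) ⁻¹'
      smallSquare) := fun n => measurable_const_smul (_ : ℝ) measurableSet_smallSquare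
  have hm := measurable_latticeMeasure stable_isCoprime
  have hle : ν.bind (latticeMeasure stable_ne_zero) smallSquare ≤ ∑' n : ℕ, c *
      volume ((fun x : Fin 2 → ℝ => ((n + 1 : ℕ) : ℝ) • x) ⁻¹' smallSquare) := by
    calc _ = ∫⁻ q, latticeMeasure stable_ne_zero q smallSquare ∂ν :=
          Measure.bind_apply measurableSet_smallSquare (measurable_latticeMeasure _).aemeasurable
      _ ≤ ∫⁻ q, ∑' n : ℕ, latticeMeasure stable_isCoprime q
          ((fun x : Fin 2 → ℝ => ((n + 1 : ℕ) : ℝ) • x) ⁻¹' smallSquare) ∂ν := by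
          refine lintegral_mono fun q => ?_
          induction q using Quotient.inductionOn' with
          | h M => exact pointMeasure_ne_zero_le_tsum M measurableSet_smallSquare
      _ = ∑' n : ℕ, ∫⁻ q, latticeMeasure stable_isCoprime q
          ((fun x : Fin 2 → ℝ => ((n + 1 : ℕ) : ℝ) • x) ⁻¹' smallSquare) ∂ν :=
          lintegral_tsum fun n => ((Measure.measurable_coe (hpre n)).comp hm).aemeasurable
      _ = _ := by
          refine tsum_congr fun n => ?_
          rw [← Measure.bind_apply (hpre n) hm.aemeasurable, hμ]
          rfl
  refine ne_top_of_le_ne_top ?_ hle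
  have hvol : ∀ n : ℕ, volume ((fun x : Fin 2 → ℝ => ((n + 1 : ℕ) : ℝ) • x) ⁻¹' smallSquare) =
      ENNReal.ofReal (1 / ((n + 1 : ℕ) : ℝ) ^ 2) * volume smallSquare := fun n => by
    rw [Measure.addHaar_preimage_smul _ (by positivity)]
    simp only [Module.finrank_fin_fun]
    rw [abs_of_pos (by positivity), one_div]
  simp_rw [hvol]
  rw [ENNReal.tsum_mul_left, ENNReal.tsum_mul_right]
  refine ENNReal.mul_ne_top hc (ENNReal.mul_ne_top ?_ measure_ball_lt_top.ne)
  exact ((summable_nat_add_iff 1).2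
    (Real.summable_one_div_nat_pow.2 one_lt_two)).tsum_ofReal_ne_top

end Average

section Counting

variable (M : SpecialLinearGroup (Fin 2) ℝ)

lemma isBounded_preimage_closedBall (r : ℝ) :
    Bornology.IsBounded ((fun x : Fin 2 → ℝ => x ᵥ* (M : Matrix (Fin 2) (Fin 2) ℝ)) ⁻¹'
      Metric.closedBall 0 r) := by
  refine ((isCompact_closedBall (0 : Fin 2 → ℝ) r).image (continuous_vecMul_right
    ((M⁻¹ : SpecialLinearGroup (Fin 2) ℝ) : Matrix (Fin 2) (Fin 2) ℝ))).isBounded.subset ?_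
  exact fun x hx => ⟨_, hx, vecMul_vecMul_cancel x (mul_inv_cancel M)⟩

lemma finite_latticePoint_mem_closedBall (r : ℝ) :
    {k : Fin 2 → ℤ | k ≠ 0 ∧ latticePoint k M ∈ Metric.closedBall 0 r}.Finite := by
  obtain ⟨R, hR⟩ := (isBounded_preimage_closedBall M r).exists_norm_le
  refine ((isCompact_closedBall (0 : Fin 2 → ℤ) (max R 0)).finite_of_discrete).subset
    fun k hk => ?_
  have h := hR _ hk.2
  rw [mem_closedBall_zero_iff, pi_norm_le_iff_of_nonneg (le_max_right _ _)]
  intro i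
  rw [← Int.norm_cast_real]
  exact ((norm_le_pi_norm (fun i => (k i : ℝ)) i).trans h).trans (le_max_left _ _)

lemma mem_span_basisFun_iff {y : Fin 2 → ℝ} :
    y ∈ (Submodule.span ℤ (Set.range (Pi.basisFun ℝ (Fin 2))) : Set (Fin 2 → ℝ)) ↔
      ∃ k : Fin 2 → ℤ, (fun i => (k i : ℝ)) = y := by
  rw [SetLike.mem_coe, Module.Basis.mem_span_iff_repr_mem]
  constructor
  · intro h
    choose k hk using h
    exact ⟨k, funext fun i => by simpa using hk i⟩
  · rintro ⟨k, rfl⟩ i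
    exact ⟨k i, by simp⟩

/-- The number of lattice points in a large square is asymptotic to its area. -/
lemma tendsto_pointMeasure_closedBall :
    Tendsto (fun n : ℕ => pointMeasure (fun v => v ≠ 0) M (Metric.closedBall 0 n) / (n : ℝ≥0∞) ^ 2)
      atTop (𝓝 (volume (Metric.closedBall (0 : Fin 2 → ℝ) 1))) := by
  let B : Set (Fin 2 → ℝ) := (fun x : Fin 2 → ℝ => x ᵥ* (M : Matrix (Fin 2) (Fin 2) ℝ)) ⁻¹'
    Metric.closedBall 0 1
  have hcont := continuous_vecMul_right (M : Matrix (Fin 2) (Fin 2) ℝ)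
  have hB : MeasurableSet B := hcont.measurable measurableSet_closedBall
  have hBb : Bornology.IsBounded B := isBounded_preimage_closedBall M 1
  have hBvol : volume B = volume (Metric.closedBall (0 : Fin 2 → ℝ) 1) :=
    invariant_volume.preimage M measurableSet_closedBall
  have hBconv : Convex ℝ B :=
    (convex_closedBall (0 : Fin 2 → ℝ) 1).linear_preimage
      (Matrix.vecMulLinear (M : Matrix (Fin 2) (Fin 2) ℝ))
  let s : Set (Fin 2 → ℝ) := B \ {0}
  have hsvol : volume s = volume (Metric.closedBall (0 : Fin 2 → ℝ) 1) := by
    rw [measure_sdiff_null (measure_singleton _), hBvol]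
  have hfr : volume (frontier s) = 0 := by
    refine measure_mono_null (t := frontier B ∪ {0}) ?_ (measure_union_null
      (hBconv.addHaar_frontier volume) (measure_singleton _))
    refine (frontier_inter_subset B {0}ᶜ).trans (Set.union_subset_union Set.inter_subset_left ?_)
    rw [frontier_compl]
    exact Set.inter_subset_right.trans isClosed_singleton.frontier_subset
  have hlim := tendsto_card_div_pow_atTop_volume s (hBb.subset Set.sdiff_subset)
    (hB.diff (measurableSet_singleton 0)) hfr
  have hlim' := ENNReal.tendsto_ofReal hlim
  rw [Measure.real, hsvol, ENNReal.ofReal_toReal measure_closedBall_lt_top.ne] at hlim'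
  refine hlim'.congr' ?_
  filter_upwards [eventually_gt_atTop 0] with n hn
  have hn' : (0 : ℝ) < n := Nat.cast_pos.2 hn
  have himage : s ∩ (n : ℝ)⁻¹ • (Submodule.span ℤ (Set.range (Pi.basisFun ℝ (Fin 2))) :
      Set (Fin 2 → ℝ)) = (fun k : Fin 2 → ℤ => (n : ℝ)⁻¹ • fun i => (k i : ℝ)) ''
        {k : Fin 2 → ℤ | k ≠ 0 ∧ latticePoint k M ∈ Metric.closedBall 0 (n : ℝ)} := by
    have hmem : ∀ k : Fin 2 → ℤ, ((n : ℝ)⁻¹ • fun i => (k i : ℝ)) ∈ s ↔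
        k ≠ 0 ∧ latticePoint k M ∈ Metric.closedBall 0 (n : ℝ) := fun k => by
      have h₁ : ((n : ℝ)⁻¹ • fun i => (k i : ℝ)) ∈ B ↔
          latticePoint k M ∈ Metric.closedBall 0 (n : ℝ) := by
        change (((n : ℝ)⁻¹ • fun i => (k i : ℝ)) ᵥ* (M : Matrix (Fin 2) (Fin 2) ℝ)) ∈
          Metric.closedBall 0 1 ↔ _
        rw [Matrix.smul_vecMul, mem_closedBall_zero_iff, mem_closedBall_zero_iff, norm_smul,
          norm_inv, Real.norm_natCast, inv_mul_le_iff₀ hn', mul_one]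
        rfl
      have h₂ : ((n : ℝ)⁻¹ • fun i => (k i : ℝ)) = 0 ↔ k = 0 := by
        rw [smul_eq_zero_iff_right (inv_ne_zero hn'.ne')]
        simp [funext_iff]
      rw [Set.mem_sdiff, Set.mem_singleton_iff, h₁, h₂, and_comm]
    ext x
    constructor
    · rintro ⟨hx, hx'⟩
      obtain ⟨y, hy, rfl⟩ := Set.mem_smul_set.1 hx'
      obtain ⟨k, rfl⟩ := mem_span_basisFun_iff.1 hy
      exact ⟨k, (hmem k).1 hx, rfl⟩
    · rintro ⟨k, hk, rfl⟩
      exact ⟨(hmem k).2 hk, Set.smul_mem_smul_set (mem_span_basisFun_iff.2 ⟨k, rfl⟩)⟩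
  have hinj : Function.Injective fun k : Fin 2 → ℤ => (n : ℝ)⁻¹ • fun i => (k i : ℝ) := by
    intro k l hkl
    have := smul_right_injective _ (inv_ne_zero hn'.ne') hkl
    exact funext fun i => Int.cast_injective (congrFun this i)
  rw [himage, Nat.card_image_of_injective hinj, Fintype.card_fin,
    pointMeasure_apply _ _ measurableSet_closedBall,
    ENNReal.ofReal_div_of_pos (by positivity), ENNReal.ofReal_natCast,
    ENNReal.ofReal_pow hn'.le, ENNReal.ofReal_natCast, Nat.card_coe_set_eq,
    ← (finite_latticePoint_mem_closedBall M n).cast_ncard_eq]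
  rfl

lemma pointMeasure_unitCell_le (c : ℤ × ℤ) :
    pointMeasure (fun v => v ≠ 0) M {x | ⌊x 0⌋ = c.1 ∧ ⌊x 1⌋ = c.2} ≤
      pointMeasure (fun v => v ≠ 0) M (Metric.closedBall 0 1) + 1 := by
  have hmeas : MeasurableSet {x : Fin 2 → ℝ | ⌊x 0⌋ = c.1 ∧ ⌊x 1⌋ = c.2} :=
    (measurableSet_eq_fun (measurable_pi_apply 0).floor measurable_const).inter
      (measurableSet_eq_fun (measurable_pi_apply 1).floor measurable_const)
  rw [pointMeasure_apply _ _ measurableSet_closedBall, pointMeasure_apply _ _ hmeas]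
  rcases Set.eq_empty_or_nonempty
    {k : Fin 2 → ℤ | k ≠ 0 ∧ latticePoint k M ∈ {x | ⌊x 0⌋ = c.1 ∧ ⌊x 1⌋ = c.2}} with h | ⟨l, hl⟩
  · rw [h]; simp
  suffices h : {k : Fin 2 → ℤ | k ≠ 0 ∧ latticePoint k M ∈
      {x | ⌊x 0⌋ = c.1 ∧ ⌊x 1⌋ = c.2}}.encard ≤
      {k : Fin 2 → ℤ | k ≠ 0 ∧ latticePoint k M ∈ Metric.closedBall 0 1}.encard + 1 by
    exact_mod_cast h
  refine le_trans ?_ (Set.encard_insert_le _ 0)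
  refine Set.encard_le_encard_of_injOn (f := fun k => k - l) (fun k hk => ?_)
    fun a _ b _ hab => sub_left_injective hab
  rw [Set.mem_insert_iff, or_iff_not_imp_left]
  refine fun hne => ⟨hne, ?_⟩
  rw [latticePoint_sub, mem_closedBall_zero_iff, pi_norm_le_iff_of_nonneg zero_le_one]
  obtain ⟨-, hk₀, hk₁⟩ := hk
  obtain ⟨-, hl₀, hl₁⟩ := hl
  intro i
  rw [Pi.sub_apply, Real.norm_eq_abs]
  fin_cases i
  · exact (Int.abs_sub_lt_one_of_floor_eq_floor (hk₀.trans hl₀.symm)).le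
  · exact (Int.abs_sub_lt_one_of_floor_eq_floor (hk₁.trans hl₁.symm)).le

lemma pointMeasure_closedBall_le (n : ℕ) :
    pointMeasure (fun v => v ≠ 0) M (Metric.closedBall 0 n) ≤
      (2 * n + 1 : ℝ≥0∞) ^ 2 * (pointMeasure (fun v => v ≠ 0) M (Metric.closedBall 0 1) + 1) := by
  let F : Finset (ℤ × ℤ) := Finset.Icc (-n : ℤ) n ×ˢ Finset.Icc (-n : ℤ) n
  have hF : F.card = (2 * n + 1) ^ 2 := by
    simp only [F, Finset.card_product, Int.card_Icc]
    rw [sq]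
    congr 1 <;> omega
  have hsub : Metric.closedBall (0 : Fin 2 → ℝ) n ⊆
      ⋃ c ∈ F, {x : Fin 2 → ℝ | ⌊x 0⌋ = c.1 ∧ ⌊x 1⌋ = c.2} := by
    intro x hx
    rw [mem_closedBall_zero_iff, pi_norm_le_iff_of_nonneg (Nat.cast_nonneg n)] at hx
    have hfloor : ∀ i, ⌊x i⌋ ∈ Finset.Icc (-n : ℤ) n := fun i => by
      have := abs_le.1 (hx i)
      rw [Finset.mem_Icc]
      refine ⟨Int.le_floor.2 (by push_cast; exact this.1), ?_⟩
      exact_mod_cast (Int.floor_le (x i)).trans this.2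
    exact Set.mem_iUnion₂.2 ⟨(⌊x 0⌋, ⌊x 1⌋), Finset.mem_product.2 ⟨hfloor 0, hfloor 1⟩, rfl, rfl⟩
  refine (measure_mono hsub).trans ((measure_biUnion_finset_le _ _).trans ?_)
  refine (Finset.sum_le_sum fun c _ => pointMeasure_unitCell_le M c).trans ?_
  rw [Finset.sum_const, nsmul_eq_mul, hF]
  push_cast
  exact le_rfl

end Counting

/-- Averaging the counting measures of the nonzero vectors of unimodular lattices over an invariant
probability measure yields Lebesgue measure. -/
theorem bind_latticeMeasure_eq_volume (ν : Measure X1) [IsProbabilityMeasure ν]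
    (hinv : ∀ g, ν.map (rightTranslate g) = ν) :
    ν.bind (latticeMeasure stable_ne_zero) = volume := by
  obtain ⟨c, hc, hμ⟩ := (invariant_bind stable_ne_zero hinv).exists_eq_smul_volume
    (bind_ne_zero_smallSquare_ne_top hinv) (bind_singleton_zero stable_ne_zero fun _ hv => hv)
  have hm := measurable_latticeMeasure stable_ne_zero
  have hint : ∀ r : ℝ, ∫⁻ q, latticeMeasure stable_ne_zero q (Metric.closedBall 0 r) ∂ν =
      c * volume (Metric.closedBall (0 : Fin 2 → ℝ) r) := fun r => by
    rw [← Measure.bind_apply measurableSet_closedBall hm.aemeasurable, hμ]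
    rfl
  set V := volume (Metric.closedBall (0 : Fin 2 → ℝ) 1) with hV
  have hVtop : V ≠ ∞ := measure_closedBall_lt_top.ne
  have hV₀ : V ≠ 0 := (Metric.measure_closedBall_pos volume _ one_pos).ne'
  have hmball : ∀ r : ℝ, Measurable fun q =>
      latticeMeasure stable_ne_zero q (Metric.closedBall 0 r) := fun r =>
    (Measure.measurable_coe measurableSet_closedBall).comp hm
  have hlim := tendsto_lintegral_of_dominated_convergence (μ := ν)
    (F := fun n q => latticeMeasure stable_ne_zero q (Metric.closedBall 0 ((n + 1 : ℕ) : ℝ)) /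
      ((n + 1 : ℕ) : ℝ≥0∞) ^ 2) (f := fun _ => V)
    (fun q => 9 * (latticeMeasure stable_ne_zero q (Metric.closedBall 0 1) + 1))
    (fun n => (hmball _).div_const _) (fun n => Eventually.of_forall fun q => ?_) ?_
    (Eventually.of_forall fun q => ?_)
  · have hleft : ∀ n : ℕ, ∫⁻ q, latticeMeasure stable_ne_zero q
        (Metric.closedBall 0 ((n + 1 : ℕ) : ℝ)) / ((n + 1 : ℕ) : ℝ≥0∞) ^ 2 ∂ν = c * V := fun n => by
      have hpos : (0 : ℝ) < ((n + 1 : ℕ) : ℝ) := by positivity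
      simp_rw [div_eq_mul_inv]
      rw [lintegral_mul_const _ (hmball _), hint, Measure.addHaar_closedBall_eq_addHaar_ball,
        Measure.addHaar_ball_of_pos _ _ hpos, ← Measure.addHaar_closedBall_eq_addHaar_ball, ← hV,
        Module.finrank_fin_fun, ENNReal.ofReal_pow hpos.le, ENNReal.ofReal_natCast, mul_assoc,
        mul_right_comm, ENNReal.mul_inv_cancel (by simp) (by simp), one_mul]
    simp_rw [hleft] at hlim
    have heq := tendsto_nhds_unique tendsto_const_nhds hlim
    rw [lintegral_const, measure_univ, mul_one] at heq
    have hc1 : c = 1 := by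
      rw [← ENNReal.mul_div_cancel_right (a := c) hV₀ hVtop, heq, ENNReal.div_self hV₀ hVtop]
    rw [hμ, hc1, one_smul]
  · induction q using Quotient.inductionOn' with
    | h M =>
      simp only [latticeMeasure_mk]
      refine ENNReal.div_le_of_le_mul ((pointMeasure_closedBall_le M (n + 1)).trans ?_)
      rw [mul_right_comm]
      gcongr
      rw [show (9 : ℝ≥0∞) = 3 ^ 2 by norm_num, ← mul_pow]
      gcongr
      norm_cast
      omega
  · rw [lintegral_const_mul _ ((hmball 1).add_const 1), lintegral_add_right _ measurable_const, hint]
    simp [ENNReal.mul_eq_top, hc]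
  · induction q using Quotient.inductionOn' with
    | h M => exact (tendsto_pointMeasure_closedBall M).comp (tendsto_add_atTop_nat 1)

/-- The Bochner integral against an averaged measure is the iterated integral. -/
lemma integral_bind_of_integrable {α β : Type*} [MeasurableSpace α] [MeasurableSpace β]
    {ν : Measure α} {κ : α → Measure β} (hκ : Measurable κ) {f : β → ℝ}
    (hf : Integrable f (ν.bind κ)) :
    (∀ᵐ a ∂ν, Integrable f (κ a)) ∧ ∫ a, ∫ x, f x ∂κ a ∂ν = ∫ x, f x ∂ν.bind κ := by
  obtain ⟨g, hg, hfg⟩ := hf.1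
  have hgi : Integrable g (ν.bind κ) := hf.congr hfg
  have hfg' : ∀ᵐ a ∂ν, f =ᵐ[κ a] g := Measure.ae_ae_of_ae_bind hκ.aemeasurable hfg
  have hgm := hg.measurable
  have hlin : ∀ h : β → ℝ≥0∞, Measurable h → Measurable fun a => ∫⁻ x, h x ∂κ a := fun h hh =>
    (Measure.measurable_lintegral hh).comp hκ
  have hfin : ∀ h : β → ℝ, Measurable h → Integrable h (ν.bind κ) →
      ∫⁻ a, ∫⁻ x, ENNReal.ofReal (h x) ∂κ a ∂ν ≠ ∞ := fun h hh hhi => by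
    rw [← Measure.lintegral_bind hκ.aemeasurable hh.ennreal_ofReal.aemeasurable]
    exact hhi.lintegral_lt_top.ne
  have hnorm : ∀ᵐ a ∂ν, Integrable g (κ a) := by
    filter_upwards [ae_lt_top (hlin _ hgm.norm.ennreal_ofReal) (hfin _ hgm.norm hgi.norm)]
      with a ha
    refine ⟨hg.aestronglyMeasurable, ?_⟩
    rwa [hasFiniteIntegral_iff_norm]
  refine ⟨?_, ?_⟩
  · filter_upwards [hfg', hnorm] with a ha hi using hi.congr ha.symm
  have hpos := hfin g hgm hgi
  have hneg := hfin (fun x => -g x) hgm.neg hgi.neg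
  have hpm := hlin _ hgm.ennreal_ofReal
  have hnm : Measurable fun a => ∫⁻ x, ENNReal.ofReal (-g x) ∂κ a :=
    hlin _ hgm.neg.ennreal_ofReal
  calc ∫ a, ∫ x, f x ∂κ a ∂ν
      = ∫ a, ((∫⁻ x, ENNReal.ofReal (g x) ∂κ a).toReal -
          (∫⁻ x, ENNReal.ofReal (-g x) ∂κ a).toReal) ∂ν := by
        refine integral_congr_ae ?_
        filter_upwards [hfg', hnorm] with a ha hi
        rw [integral_congr_ae ha, integral_eq_lintegral_pos_part_sub_lintegral_neg_part hi]
    _ = ∫ x, g x ∂ν.bind κ := by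
        rw [integral_sub (integrable_toReal_of_lintegral_ne_top hpm.aemeasurable hpos)
          (integrable_toReal_of_lintegral_ne_top hnm.aemeasurable hneg),
          integral_toReal hpm.aemeasurable (ae_lt_top hpm hpos),
          integral_toReal hnm.aemeasurable (ae_lt_top hnm hneg),
          integral_eq_lintegral_pos_part_sub_lintegral_neg_part hgi,
          Measure.lintegral_bind hκ.aemeasurable hgm.ennreal_ofReal.aemeasurable,
          Measure.lintegral_bind (f := fun x => ENNReal.ofReal (-g x)) hκ.aemeasurable
            hgm.neg.ennreal_ofReal.aemeasurable]
    _ = _ := (integral_congr_ae hfg).symm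

end SiegelFormula

theorem stmt_14
    (ν₁ : Measure X1) [IsProbabilityMeasure ν₁]
    (hinv : ∀ g : Matrix.SpecialLinearGroup (Fin 2) ℝ,
      Measure.map (rightTranslate g) ν₁ = ν₁)
    (f : (Fin 2 → ℝ) → ℝ) (hf : Integrable f (volume : Measure (Fin 2 → ℝ)))
    (Φ : X1 → ℝ)
    (hΦ : ∀ M : Matrix.SpecialLinearGroup (Fin 2) ℝ,
      Φ (Quotient.mk'' M) =
        ∑' k : {v : Fin 2 → ℤ // v ≠ 0},
          f ((fun i => ((k : Fin 2 → ℤ) i : ℝ)) ᵥ* (M : Matrix (Fin 2) (Fin 2) ℝ))) :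
    ∫ q, Φ q ∂ν₁ = ∫ x, f x ∂(volume : Measure (Fin 2 → ℝ)) := by
  have hvol := SiegelFormula.bind_latticeMeasure_eq_volume ν₁ hinv
  rw [← hvol] at hf ⊢
  obtain ⟨hi, hint⟩ := SiegelFormula.integral_bind_of_integrable
    (SiegelFormula.measurable_latticeMeasure SiegelFormula.stable_ne_zero) hf
  rw [← hint]
  refine integral_congr_ae ?_
  filter_upwards [hi] with q hq
  induction q using Quotient.inductionOn' with
  | h M =>
    rw [hΦ, SiegelFormula.latticeMeasure_mk, SiegelFormula.pointMeasure, integral_sum_measure hq]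
    simp only [integral_dirac]
    rfl
end
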